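/- Let G = (V, E, w) be a finite directed weighted graph and let (v_t)_{t ∈ ℕ} be an infinite path in G, i.e., (v_t, v_{t+1}) ∈ E for all t ≥ 0. Then G contains at least one cycle, and, with μ* denoting the minimum mean weight over all cycles of G, liminf_{T → ∞} (1/T) Σ_{t=0}^{T−1} w(v_t, v_{t+1}) ≥ μ*. -/

import Mathlib

/-- `p` is a path (walk) in the directed graph with edge relation `E`:
a nonempty list of vertices with consecutive vertices joined by edges. -/
def IsWalk {V : Type*} (E : V → V → Prop) (p : List V) : Prop :=
  p ≠ [] ∧ p.Chain' E

/-- The multiset of edges of a path, counted with multiplicity. -/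
def edgeMS {V : Type*} (p : List V) : Multiset (V × V) :=
  ↑(p.zip p.tail)

/-- The number of edges ψ(p) of a path. -/
def numEdges {V : Type*} (p : List V) : ℕ := p.length - 1

/-- The weight of a path: the sum of the weights of its edges. -/
def pathWeight {V : Type*} (w : V → V → ℝ) (p : List V) : ℝ :=
  ((p.zip p.tail).map (fun e => w e.1 e.2)).sum

/-- A cycle: a path with at least one edge whose first and last vertices coincide. -/
def IsCycle {V : Type*} (E : V → V → Prop) (p : List V) : Prop :=
  IsWalk E p ∧ 2 ≤ p.length ∧ p.head? = p.getLast?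

/-- A simple cycle: a cycle ⟨v₀, …, v_k, v₀⟩ whose vertices v₀, …, v_k are pairwise
distinct (i.e. no repeated vertices except first = last). -/
def IsSimpleCycle {V : Type*} (E : V → V → Prop) (p : List V) : Prop :=
  IsCycle E p ∧ p.dropLast.Nodup

/-- The mean weight w̄(c) = w(c)/ψ(c) of a cycle (or path). -/
noncomputable def meanWeight {V : Type*} (w : V → V → ℝ) (p : List V) : ℝ :=
  pathWeight w p / (numEdges p : ℝ)

open Filter Topology

section Walks

variable {V : Type*} {E : V → V → Prop} {w : V → V → ℝ}

theorem isWalk_iff {p : List V} : IsWalk E p ↔ p ≠ [] ∧ p.IsChain E := Iff.rfl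

@[simp]
theorem pathWeight_singleton (x : V) : pathWeight w [x] = 0 := by
  simp [pathWeight]

@[simp]
theorem pathWeight_cons_cons (x y : V) (p : List V) :
    pathWeight w (x :: y :: p) = w x y + pathWeight w (y :: p) := by
  simp [pathWeight]

theorem pathWeight_append_cons (a : List V) (x : V) (c : List V) :
    pathWeight w (a ++ x :: c) = pathWeight w (a ++ [x]) + pathWeight w (x :: c) := by
  induction a with
  | nil => simp
  | cons y a ih =>
    cases a with
    | nil => simp
    | cons z a =>
      simp only [List.cons_append, pathWeight_cons_cons] at ih ⊢
      rw [ih, add_assoc]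

theorem pathWeight_sub_const (μ : ℝ) (p : List V) :
    pathWeight (fun x y => w x y - μ) p = pathWeight w p - μ * numEdges p := by
  induction p with
  | nil => simp [pathWeight, numEdges]
  | cons x p ih =>
    cases p with
    | nil => simp [numEdges]
    | cons y p =>
      rw [pathWeight_cons_cons, pathWeight_cons_cons, ih]
      simp only [numEdges, List.length_cons, Nat.add_sub_cancel]
      push_cast
      ring

/-- The first `n` edges of an infinite path. -/
def pathPrefix (v : ℕ → V) (n : ℕ) : List V := (List.range (n + 1)).map v

@[simp]
theorem length_pathPrefix (v : ℕ → V) (n : ℕ) : (pathPrefix v n).length = n + 1 := by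
  simp [pathPrefix]

@[simp]
theorem numEdges_pathPrefix (v : ℕ → V) (n : ℕ) : numEdges (pathPrefix v n) = n := by
  simp [numEdges]

theorem pathPrefix_succ (v : ℕ → V) (n : ℕ) :
    pathPrefix v (n + 1) = v 0 :: pathPrefix (fun i => v (i + 1)) n := by
  rw [pathPrefix, List.range_succ_eq_map]
  simp [pathPrefix, Function.comp_def]

theorem head?_pathPrefix (v : ℕ → V) (n : ℕ) : (pathPrefix v n).head? = some (v 0) := by
  simp [pathPrefix, List.range_succ_eq_map]

theorem getLast?_pathPrefix (v : ℕ → V) (n : ℕ) : (pathPrefix v n).getLast? = some (v n) := by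
  simp [pathPrefix, List.range_succ]

theorem isWalk_pathPrefix {v : ℕ → V} (hv : ∀ t, E (v t) (v (t + 1))) (n : ℕ) :
    IsWalk E (pathPrefix v n) := by
  refine isWalk_iff.2 ⟨by simp [pathPrefix], ?_⟩
  rw [List.isChain_iff_getElem]
  intro i hi
  simpa [pathPrefix] using hv i

theorem pathWeight_pathPrefix (v : ℕ → V) (n : ℕ) :
    pathWeight w (pathPrefix v n) = ∑ t ∈ Finset.range n, w (v t) (v (t + 1)) := by
  induction n generalizing v with
  | zero => simp [pathPrefix]
  | succ n ih =>
    have hcons : ∃ l, pathPrefix (fun i => v (i + 1)) n = v 1 :: l := by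
      simp [pathPrefix, List.range_succ_eq_map]
    obtain ⟨l, hl⟩ := hcons
    rw [pathPrefix_succ, hl, pathWeight_cons_cons, ← hl, ih, Finset.sum_range_succ', add_comm]

theorem IsCycle.numEdges_pos {c : List V} (hc : IsCycle E c) : (0 : ℝ) < numEdges c := by
  have := hc.2.1
  exact_mod_cast (by unfold numEdges; omega : 0 < numEdges c)

variable [Fintype V]

/-- Excising nonnegative cycles from a walk yields a walk without repeated vertices, with the
same endpoints and no greater weight. -/
theorem exists_nodup_walk_pathWeight_le
    (h : ∀ c, IsCycle E c → c.length ≤ Fintype.card V + 1 → 0 ≤ pathWeight w c)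
    {p : List V} (hp : IsWalk E p) :
    ∃ q, IsWalk E q ∧ q.Nodup ∧ q.head? = p.head? ∧ q.getLast? = p.getLast? ∧
      pathWeight w q ≤ pathWeight w p := by
  induction p with
  | nil => exact absurd rfl hp.1
  | cons x p ih =>
    cases p with
    | nil => exact ⟨[x], hp, by simp, rfl, rfl, le_rfl⟩
    | cons y p =>
      have hp' := List.isChain_cons_cons.1 (isWalk_iff.1 hp).2
      obtain ⟨q, hq, hnd, hhead, hlast, hle⟩ := ih (isWalk_iff.2 ⟨by simp, hp'.2⟩)
      obtain ⟨r, rfl⟩ : ∃ r, q = y :: r := by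
        cases q with
        | nil => simp at hhead
        | cons z r => exact ⟨r, by simpa using hhead⟩
      have hwalk : (x :: y :: r).IsChain E := List.isChain_cons_cons.2 ⟨hp'.1, hq.2⟩
      have hle' : pathWeight w (x :: y :: r) ≤ pathWeight w (x :: y :: p) := by
        simpa using hle
      have hlast' : (x :: y :: r).getLast? = (x :: y :: p).getLast? := by
        simpa [List.getLast?_cons_cons] using hlast
      by_cases hx : x ∈ y :: r
      · obtain ⟨s, t, hst⟩ := List.append_of_mem hx
        rw [hst] at hwalk hle' hlast' hnd
        rw [← List.cons_append] at hwalk hle' hlast'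
        have hlen := hnd.length_le_card
        have hchain := List.isChain_split.1 hwalk
        have hcyc : 0 ≤ pathWeight w (x :: s ++ [x]) := by
          refine h _ ⟨isWalk_iff.2 ⟨by simp, hchain.1⟩, by simp,
            by rw [List.getLast?_append]; simp⟩ ?_
          simp at hlen ⊢
          omega
        rw [pathWeight_append_cons] at hle'
        refine ⟨x :: t, isWalk_iff.2 ⟨by simp, hchain.2⟩, (List.nodup_append.1 hnd).2.1, rfl,
          ?_, by linarith⟩
        rw [← hlast', List.getLast?_append]
        simp [List.getLast?_cons]
      · exact ⟨x :: y :: r, isWalk_iff.2 ⟨by simp, hwalk⟩, List.nodup_cons.2 ⟨hx, hnd⟩, rfl,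
          hlast', hle'⟩

/-- If the cycles short enough to be simple have nonnegative weight, so do all cycles. -/
theorem IsCycle.pathWeight_nonneg
    (h : ∀ c, IsCycle E c → c.length ≤ Fintype.card V + 1 → 0 ≤ pathWeight w c)
    {c : List V} (hc : IsCycle E c) : 0 ≤ pathWeight w c := by
  obtain ⟨q, hq, hnd, hhead, hlast, hle⟩ := exists_nodup_walk_pathWeight_le h hc.1
  have hends : q.head? = q.getLast? := by rw [hhead, hlast, hc.2.2]
  match q, hq.1 with
  | [x], _ => simpa using hle
  | x :: y :: r, _ =>
    refine absurd ?_ (List.nodup_cons.1 hnd).1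
    rw [List.getLast?_cons_cons] at hends
    exact List.mem_of_getLast? (hends.symm.trans rfl)

/-- If cycles have nonnegative weight, then the weights of walks are bounded below. -/
theorem exists_forall_neg_le_pathWeight
    (h : ∀ c, IsCycle E c → c.length ≤ Fintype.card V + 1 → 0 ≤ pathWeight w c) :
    ∃ C, ∀ p, IsWalk E p → -C ≤ pathWeight w p := by
  have hfin : {q : List V | q.Nodup}.Finite :=
    (List.finite_length_le V (Fintype.card V)).subset fun q hq => List.Nodup.length_le_card hq
  obtain ⟨b, hb⟩ := (hfin.image (pathWeight w)).bddBelow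
  refine ⟨-b, fun p hp => ?_⟩
  obtain ⟨q, -, hnd, -, -, hle⟩ := exists_nodup_walk_pathWeight_le h hp
  rw [neg_neg]
  exact (hb ⟨q, hnd, rfl⟩).trans hle

theorem exists_isCycle_length_le {v : ℕ → V} (hv : ∀ t, E (v t) (v (t + 1))) :
    ∃ c, IsCycle E c ∧ c.length ≤ Fintype.card V + 1 := by
  obtain ⟨i, j, hne, hij⟩ := Fintype.exists_ne_map_eq_of_card_lt
    (fun i : Fin (Fintype.card V + 1) => v i) (by simp)
  wlog hlt : i < j generalizing i j
  · exact this j i hne.symm hij.symm (hne.lt_or_gt.resolve_left hlt)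
  have hlt' : (i : ℕ) < j := hlt
  refine ⟨pathPrefix (fun t => v (i + t)) (j - i),
    ⟨isWalk_pathPrefix (fun t => hv (i + t)) _, by rw [length_pathPrefix]; omega, ?_⟩,
    by rw [length_pathPrefix]; omega⟩
  rw [head?_pathPrefix, getLast?_pathPrefix, Nat.add_zero, Nat.add_sub_cancel' hlt'.le]
  exact congrArg some hij

end Walks

/-- If partial sums of a bounded sequence exceed `μ * T - C`, then the limit inferior of the
averages is at least `μ`. -/
theorem le_liminf_average {f : ℕ → ℝ} {μ C M : ℝ} (hM : ∀ t, f t ≤ M)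
    (hC : ∀ T : ℕ, μ * T - C ≤ ∑ t ∈ Finset.range T, f t) :
    μ ≤ liminf (fun T : ℕ => (∑ t ∈ Finset.range T, f t) / (T : ℝ)) atTop := by
  have hlim : Tendsto (fun T : ℕ => μ - C / (T : ℝ)) atTop (𝓝 μ) := by
    simpa using tendsto_const_nhds.sub (tendsto_const_div_atTop_nhds_zero_nat C)
  have hbdd : IsBoundedUnder (· ≤ ·) atTop
      (fun T : ℕ => (∑ t ∈ Finset.range T, f t) / (T : ℝ)) := by
    refine isBoundedUnder_of_eventually_le (a := M) ?_
    filter_upwards [eventually_gt_atTop 0] with T hT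
    rw [div_le_iff₀ (by exact_mod_cast hT)]
    calc ∑ t ∈ Finset.range T, f t ≤ ∑ _t ∈ Finset.range T, M :=
          Finset.sum_le_sum fun t _ => hM t
      _ = M * T := by simp [mul_comm]
  rw [← hlim.liminf_eq]
  refine liminf_le_liminf ?_ hlim.isBoundedUnder_ge hbdd.isCoboundedUnder_ge
  filter_upwards [eventually_gt_atTop 0] with T hT
  have hT' : (0 : ℝ) < T := by exact_mod_cast hT
  rw [le_div_iff₀ hT', sub_mul, div_mul_cancel₀ _ hT'.ne']
  exact hC T


/-- infinite paths have average weight at least the minimum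
cycle mean. If a finite directed weighted graph admits an infinite path
`(v_t)_{t ∈ ℕ}`, then the graph contains at least one cycle (so the minimum
mean weight `μ` over all cycles exists and is attained), and
`liminf_{T → ∞} (1/T) Σ_{t=0}^{T−1} w(v_t, v_{t+1}) ≥ μ`. -/
theorem stmt8 {V : Type*} [Fintype V] (E : V → V → Prop) (w : V → V → ℝ)
    (v : ℕ → V) (hv : ∀ t : ℕ, E (v t) (v (t + 1))) :
    ∃ μ : ℝ, IsLeast {m : ℝ | ∃ c, IsCycle E c ∧ m = meanWeight w c} μ ∧
      μ ≤ Filter.liminf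
        (fun T : ℕ => (∑ t ∈ Finset.range T, w (v t) (v (t + 1))) / (T : ℝ))
        Filter.atTop := by
  have hfin : {c | IsCycle E c ∧ c.length ≤ Fintype.card V + 1}.Finite :=
    (List.finite_length_le V (Fintype.card V + 1)).subset fun c hc => hc.2
  obtain ⟨c₀, ⟨hc₀, -⟩, hmin⟩ :=
    Set.exists_min_image _ (meanWeight w) hfin (exists_isCycle_length_le hv)
  have hshort : ∀ c, IsCycle E c → c.length ≤ Fintype.card V + 1 →
      0 ≤ pathWeight (fun x y => w x y - meanWeight w c₀) c := by
    intro c hc hlen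
    rw [pathWeight_sub_const, sub_nonneg, ← le_div_iff₀ hc.numEdges_pos]
    exact hmin c ⟨hc, hlen⟩
  refine ⟨meanWeight w c₀, ⟨⟨c₀, hc₀, rfl⟩, ?_⟩, ?_⟩
  · rintro _ ⟨c, hc, rfl⟩
    have hnonneg := hc.pathWeight_nonneg hshort
    rwa [pathWeight_sub_const, sub_nonneg, ← le_div_iff₀ hc.numEdges_pos] at hnonneg
  · obtain ⟨C, hC⟩ := exists_forall_neg_le_pathWeight hshort
    obtain ⟨M, hM⟩ := (Set.finite_range fun e : V × V => w e.1 e.2).bddAbove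
    refine le_liminf_average (C := C) (fun t => hM ⟨(v t, v (t + 1)), rfl⟩) fun T => ?_
    have hT := hC _ (isWalk_pathPrefix hv T)
    rw [pathWeight_sub_const, pathWeight_pathPrefix, numEdges_pathPrefix] at hT
    linarith
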